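/- arXiv:2503.08949 — 5 statements merged into one kernel-verified Lean document; each statement's English description precedes it below -/
import Mathlib

section
/- There exists a constant C > 0 such that for every s ∈ [0,1] and every A ∈ ℝ, the integral I(A) = ∫_ℝ dx / ((1 + (x − A)²)(1 + |x|^{2−s})) satisfies I(A) ≤ C, and moreover I(A) ≤ C·|A|^{−(2−s)} whenever A ≠ 0. -/
open MeasureTheory Real

lemma mul_one_add_sq_le_of_two_mul_le {s a d y : ℝ} (hs0 : 0 ≤ s) (hs1 : s ≤ 1) (hy : 0 ≤ y)
    (hya : 2 * y ≤ a) (had : a ≤ 2 * d) :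
    a ^ (2 - s) * (1 + y ^ 2) ≤ 8 * ((1 + d ^ 2) * (1 + y ^ (2 - s))) := by
  have ha : 0 ≤ a := by linarith
  have hyp : 0 ≤ y ^ (2 - s) := rpow_nonneg hy _
  have hap : 0 ≤ a ^ (2 - s) := rpow_nonneg ha _
  have hd : a ^ 2 ≤ 4 * d ^ 2 := by nlinarith
  rcases le_total y 1 with h1 | h1
  · have h2 : a ^ (2 - s) ≤ 1 + a ^ 2 := by
      rcases le_total a 1 with h | h
      · have := rpow_le_one ha h (by linarith : 0 ≤ 2 - s)
        nlinarith [sq_nonneg a]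
      · have := rpow_le_rpow_of_exponent_le h (by linarith : 2 - s ≤ 2)
        rw [rpow_two] at this
        linarith
    have h3 : a ^ (2 - s) ≤ 4 * (1 + d ^ 2) := by linarith
    have h4 : 1 + y ^ 2 ≤ 2 * (1 + y ^ (2 - s)) := by nlinarith
    calc _ ≤ (4 * (1 + d ^ 2)) * (2 * (1 + y ^ (2 - s))) := by gcongr
      _ = _ := by ring
  · have ha2 : a ^ 2 = a ^ (2 - s) * a ^ s := by
      rw [← rpow_add (by linarith), ← rpow_two]; norm_num
    have hy2 : y ^ 2 = y ^ (2 - s) * y ^ s := by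
      rw [← rpow_add (by linarith), ← rpow_two]; norm_num
    have hle : y ^ s ≤ a ^ s := rpow_le_rpow hy (by linarith) hs0
    have hkey : a ^ (2 - s) * y ^ 2 ≤ a ^ 2 * y ^ (2 - s) := by
      calc _ = a ^ (2 - s) * y ^ (2 - s) * y ^ s := by rw [hy2]; ring
        _ ≤ a ^ (2 - s) * y ^ (2 - s) * a ^ s := by gcongr
        _ = _ := by rw [ha2]; ring
    calc _ ≤ a ^ (2 - s) * (2 * y ^ 2) := by gcongr; nlinarith
      _ ≤ 2 * (a ^ 2 * y ^ (2 - s)) := by linarith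
      _ ≤ 2 * (4 * d ^ 2 * y ^ (2 - s)) := by gcongr
      _ ≤ _ := by nlinarith [sq_nonneg d]

lemma rpow_abs_mul_inv_le {s : ℝ} (hs0 : 0 ≤ s) (hs1 : s ≤ 1) (A x : ℝ) :
    |A| ^ (2 - s) * ((1 + (x - A) ^ 2) * (1 + |x| ^ (2 - s)))⁻¹ ≤
      8 * (1 + x ^ 2)⁻¹ + 4 * (1 + (x - A) ^ 2)⁻¹ := by
  have hyp : 0 ≤ |x| ^ (2 - s) := rpow_nonneg (abs_nonneg x) _
  rcases le_total (2 * |x|) |A| with h | h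
  · have htri : |A| ≤ 2 * |x - A| := by
      have := abs_sub_abs_le_abs_sub A x
      rw [abs_sub_comm] at this
      linarith
    have hmain := mul_one_add_sq_le_of_two_mul_le hs0 hs1 (abs_nonneg x) h htri
    rw [sq_abs, sq_abs] at hmain
    have : |A| ^ (2 - s) * ((1 + (x - A) ^ 2) * (1 + |x| ^ (2 - s)))⁻¹ ≤ 8 * (1 + x ^ 2)⁻¹ := by
      rw [← div_eq_mul_inv, ← div_eq_mul_inv, div_le_div_iff₀ (by positivity) (by positivity)]
      exact hmain
    have : 0 ≤ 4 * (1 + (x - A) ^ 2)⁻¹ := by positivity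
    linarith
  · have h2 : (2 : ℝ) ^ (2 - s) ≤ 4 := by
      have := rpow_le_rpow_of_exponent_le (by norm_num : (1 : ℝ) ≤ 2) (by linarith : 2 - s ≤ 2)
      rw [rpow_two] at this
      linarith
    have hA : |A| ^ (2 - s) ≤ 4 * (1 + |x| ^ (2 - s)) := by
      calc _ ≤ (2 * |x|) ^ (2 - s) := rpow_le_rpow (abs_nonneg A) h (by linarith)
        _ = 2 ^ (2 - s) * |x| ^ (2 - s) := mul_rpow (by norm_num) (abs_nonneg x)
        _ ≤ 4 * (1 + |x| ^ (2 - s)) := by nlinarith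
    have : |A| ^ (2 - s) * ((1 + (x - A) ^ 2) * (1 + |x| ^ (2 - s)))⁻¹ ≤
        4 * (1 + (x - A) ^ 2)⁻¹ := by
      rw [← div_eq_mul_inv, ← div_eq_mul_inv, div_le_div_iff₀ (by positivity) (by positivity)]
      nlinarith [mul_le_mul_of_nonneg_left hA (by positivity : 0 ≤ 1 + (x - A) ^ 2)]
    have : 0 ≤ 8 * (1 + x ^ 2)⁻¹ := by positivity
    linarith

/-- There exists a constant `C > 0` such that for every `s ∈ [0,1]` and
every `A ∈ ℝ`, the integral `I(A) = ∫ dx / ((1 + (x − A)²)(1 + |x|^(2−s)))` satisfies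
`I(A) ≤ C`, and `I(A) ≤ C·|A|^(−(2−s))` whenever `A ≠ 0`. -/
theorem stmt0 :
    ∃ C : ℝ, 0 < C ∧ ∀ s ∈ Set.Icc (0 : ℝ) 1, ∀ A : ℝ,
      (∫ x : ℝ, ((1 + (x - A) ^ 2) * (1 + |x| ^ (2 - s)))⁻¹) ≤ C ∧
      (A ≠ 0 →
        (∫ x : ℝ, ((1 + (x - A) ^ 2) * (1 + |x| ^ (2 - s)))⁻¹) ≤ C * |A| ^ (-(2 - s))) := by
  refine ⟨12 * π, by positivity, fun s ⟨hs0, hs1⟩ A => ?_⟩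
  have hint : Integrable fun x : ℝ => (1 + (x - A) ^ 2)⁻¹ :=
    integrable_inv_one_add_sq.comp_sub_right A
  have hval : ∫ x : ℝ, (1 + (x - A) ^ 2)⁻¹ = π := by
    rw [integral_sub_right_eq_self (fun x : ℝ => (1 + x ^ 2)⁻¹) A]
    exact integral_univ_inv_one_add_sq
  have hnonneg (x : ℝ) : 0 ≤ ((1 + (x - A) ^ 2) * (1 + |x| ^ (2 - s)))⁻¹ := by positivity
  constructor
  · calc _ ≤ ∫ x : ℝ, (1 + (x - A) ^ 2)⁻¹ := by
          refine integral_mono_of_nonneg (.of_forall hnonneg) hint (.of_forall fun x => ?_)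
          refine inv_anti₀ (by positivity) (le_mul_of_one_le_right (by positivity) ?_)
          linarith [rpow_nonneg (abs_nonneg x) (2 - s)]
      _ ≤ _ := by rw [hval]; linarith [pi_pos]
  · intro hA
    have hApos : 0 < |A| ^ (2 - s) := rpow_pos_of_pos (abs_pos.mpr hA) _
    rw [rpow_neg (abs_nonneg A), ← div_eq_mul_inv, le_div_iff₀' hApos, ← integral_const_mul]
    calc _ ≤ ∫ x : ℝ, (8 * (1 + x ^ 2)⁻¹ + 4 * (1 + (x - A) ^ 2)⁻¹) := by
          refine integral_mono_of_nonneg (.of_forall fun x => mul_nonneg hApos.le (hnonneg x))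
            ((integrable_inv_one_add_sq.const_mul 8).add (hint.const_mul 4))
            (.of_forall fun x => rpow_abs_mul_inv_le hs0 hs1 A x)
      _ = 12 * π := by
          rw [integral_add (integrable_inv_one_add_sq.const_mul 8) (hint.const_mul 4),
            integral_const_mul, integral_const_mul, hval, integral_univ_inv_one_add_sq]
          ring
end

section
/- For every B > 0 there exists a constant c = c(B) > 0 such that for every A ∈ ℝ and every s ∈ (0,1), ∫_{\{x : |x| ≥ B\}} dx / ((1 + (x − A)²)·|x|^{2−s}) ≥ c / (1 + |A|^{2−s}). -/
open MeasureTheory Real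

/-- The kernel `1 / ((1 + (x - A)²) |x|^p)` is integrable away from the origin. -/
lemma integrableOn_inv_one_add_sq_mul_rpow {B p : ℝ} (hB : 0 < B) (hp : 0 ≤ p) (A : ℝ) :
    IntegrableOn (fun x : ℝ => ((1 + (x - A) ^ 2) * |x| ^ p)⁻¹) {x : ℝ | B ≤ |x|} := by
  have hmeas : MeasurableSet {x : ℝ | B ≤ |x|} :=
    measurableSet_le measurable_const measurable_id.abs
  have hint : Integrable (fun x : ℝ => (B ^ p)⁻¹ * (1 + (x - A) ^ 2)⁻¹) :=
    (integrable_inv_one_add_sq.comp_sub_right A).const_mul _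
  refine Integrable.mono' hint.integrableOn ?_ ?_
  · exact Measurable.aestronglyMeasurable (by fun_prop)
  · filter_upwards [ae_restrict_mem hmeas] with x (hx : B ≤ |x|)
    have hBp : 0 < B ^ p := rpow_pos_of_pos hB p
    have hle : B ^ p ≤ |x| ^ p := rpow_le_rpow hB.le hx hp
    rw [norm_of_nonneg (by positivity), mul_inv, mul_comm]
    gcongr

/-- For exponents in `[0, 2]` and `D ≥ 1`, `(a + D)^p` is at most `4 D² (1 + a^p)`. -/
lemma add_rpow_le_four_mul_sq_mul {a D p : ℝ} (ha : 0 ≤ a) (hD : 1 ≤ D) (hp : 0 ≤ p)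
    (hp2 : p ≤ 2) : (a + D) ^ p ≤ 4 * D ^ 2 * (1 + a ^ p) := by
  have hap : 0 ≤ a ^ p := rpow_nonneg ha p
  have hle_sq : ∀ {y : ℝ}, 1 ≤ y → y ^ p ≤ y ^ 2 := fun hy => by
    simpa using rpow_le_rpow_of_exponent_le hy hp2
  rcases le_total a 1 with h | h
  · calc (a + D) ^ p ≤ (2 * D) ^ p := rpow_le_rpow (by linarith) (by linarith) hp
      _ ≤ (2 * D) ^ 2 := hle_sq (by linarith)
      _ ≤ 4 * D ^ 2 * (1 + a ^ p) := by nlinarith [mul_nonneg (sq_nonneg D) hap]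
  · calc (a + D) ^ p ≤ (2 * D * a) ^ p :=
          rpow_le_rpow (by linarith) (by nlinarith) hp
      _ = (2 * D) ^ p * a ^ p := mul_rpow (by linarith) ha
      _ ≤ (2 * D) ^ 2 * a ^ p := by
          gcongr
          exact hle_sq (by linarith)
      _ ≤ 4 * D ^ 2 * (1 + a ^ p) := by nlinarith [sq_nonneg D]

/-- There is a unit interval outside `(-B, B)` and within distance `B + 1` of `A`. -/
lemma exists_Icc_subset_le_abs {B : ℝ} (hB : 0 < B) (A : ℝ) :
    ∃ a : ℝ, ∀ x ∈ Set.Icc a (a + 1), B ≤ |x| ∧ |x - A| ≤ B + 1 := by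
  rcases le_total 0 A with hA | hA
  · refine ⟨A + B, fun x hx => ⟨le_abs.2 (Or.inl ?_), abs_le.2 ⟨?_, ?_⟩⟩⟩ <;>
      linarith [hx.1, hx.2]
  · refine ⟨A - B - 1, fun x hx => ⟨le_abs.2 (Or.inr ?_), abs_le.2 ⟨?_, ?_⟩⟩⟩ <;>
      linarith [hx.1, hx.2]

/-- For every `B > 0` there exists `c = c(B) > 0` such that for every
`A ∈ ℝ` and every `s ∈ (0,1)`,
`∫_{|x| ≥ B} dx / ((1 + (x − A)²)·|x|^(2−s)) ≥ c / (1 + |A|^(2−s))`. -/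
theorem stmt1 (B : ℝ) (hB : 0 < B) :
    ∃ c : ℝ, 0 < c ∧ ∀ A : ℝ, ∀ s ∈ Set.Ioo (0 : ℝ) 1,
      c / (1 + |A| ^ (2 - s)) ≤
        ∫ x in {x : ℝ | B ≤ |x|}, ((1 + (x - A) ^ 2) * |x| ^ (2 - s))⁻¹ := by
  refine ⟨((1 + (B + 1) ^ 2) * (4 * (B + 1) ^ 2))⁻¹, by positivity, fun A s hs => ?_⟩
  have hp : 0 ≤ 2 - s := by linarith [hs.2]
  have hp2 : 2 - s ≤ 2 := by linarith [hs.1]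
  obtain ⟨a, ha⟩ := exists_Icc_subset_le_abs hB A
  have hint := integrableOn_inv_one_add_sq_mul_rpow hB hp A
  have hsub : Set.Icc a (a + 1) ⊆ {x : ℝ | B ≤ |x|} := fun x hx => (ha x hx).1
  refine le_trans ?_ (setIntegral_mono_set hint
    (Filter.Eventually.of_forall fun x => by dsimp; positivity) hsub.eventuallyLE)
  have hbound : ∀ x ∈ Set.Icc a (a + 1),
      ((1 + (B + 1) ^ 2) * (4 * (B + 1) ^ 2))⁻¹ / (1 + |A| ^ (2 - s)) ≤
        ((1 + (x - A) ^ 2) * |x| ^ (2 - s))⁻¹ := fun x hx => by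
    obtain ⟨hBx, hxA⟩ := ha x hx
    have hx0 : 0 < |x| := hB.trans_le hBx
    have hsq : (x - A) ^ 2 ≤ (B + 1) ^ 2 := sq_le_sq' (abs_le.1 hxA).1 (abs_le.1 hxA).2
    have habs : |x| ≤ |A| + (B + 1) := by linarith [abs_sub_abs_le_abs_sub x A]
    have hpow : |x| ^ (2 - s) ≤ 4 * (B + 1) ^ 2 * (1 + |A| ^ (2 - s)) :=
      (rpow_le_rpow hx0.le habs hp).trans
        (add_rpow_le_four_mul_sq_mul (abs_nonneg A) (by linarith) hp hp2)
    rw [div_eq_mul_inv, ← mul_inv, mul_assoc]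
    have hxp : 0 < |x| ^ (2 - s) := rpow_pos_of_pos hx0 _
    gcongr
  have := setIntegral_mono_on (integrableOn_const (by simp)) (hint.mono_set hsub)
    measurableSet_Icc hbound
  simpa using this
end

section
/- Let s ∈ (0,1), t > 0, E ∈ ℝ, C₀ > 0, and let q : ℝ → [0,∞) be measurable with q(x) ≤ C₀/(1 + (x + E)²) for all x ∈ ℝ. Then there exists a constant C = C(s, t, E, C₀) > 0 such that for every measurable u : ℝ → ℝ with ‖u‖ < ∞, the function Fu satisfies ‖Fu‖ ≤ C‖u‖. -/
open MeasureTheory Real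

/-- The transfer operator `F` with parameters `s`, `t` and kernel density `q`:
`(Fu)(x) = (t^{2−s}/|x|^{2−s}) ∫ q(−y − t²/x) u(y) dy` for `x ≠ 0`, and `(Fu)(0) = 0`. -/
noncomputable def Fop (s t : ℝ) (q u : ℝ → ℝ) : ℝ → ℝ := fun x =>
  if x = 0 then 0
  else (t ^ (2 - s) / |x| ^ (2 - s)) * ∫ y : ℝ, q (-y - t ^ 2 / x) * u y

/-- The weight function `w(x) = 1 + |x|^{2−s}`. -/
noncomputable def wfun (s x : ℝ) : ℝ := 1 + |x| ^ (2 - s)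

/-- The weighted supremum norm `‖f‖ = sup_x |f(x)|·w(x)`. -/
noncomputable def xnorm (s : ℝ) (f : ℝ → ℝ) : ℝ := ⨆ x : ℝ, |f x| * wfun s x

/-- `f : ℝ → ℝ` is a probability density. -/
def IsProbDensity (f : ℝ → ℝ) : Prop :=
  Measurable f ∧ (∀ x, 0 ≤ f x) ∧ (∫ x, f x) = 1

/-- Quasi-triangle inequality for the power `p ∈ [0, 2]` of the absolute value. -/
lemma abs_add_rpow_le {p : ℝ} (hp0 : 0 ≤ p) (hp2 : p ≤ 2) (a b : ℝ) :
    |a + b| ^ p ≤ 4 * (|a| ^ p + |b| ^ p) := by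
  have hbase : |a + b| ≤ 2 * max |a| |b| := by
    linarith [abs_add_le a b, le_max_left |a| |b|, le_max_right |a| |b|]
  have hm : 0 ≤ max |a| |b| := (abs_nonneg a).trans (le_max_left _ _)
  have hmax : (max |a| |b|) ^ p ≤ |a| ^ p + |b| ^ p := by
    rcases max_choice |a| |b| with h | h <;> rw [h]
    · linarith [rpow_nonneg (abs_nonneg b) p]
    · linarith [rpow_nonneg (abs_nonneg a) p]
  have htwo : (2 : ℝ) ^ p ≤ 4 := by
    calc (2 : ℝ) ^ p ≤ 2 ^ (2 : ℝ) := rpow_le_rpow_of_exponent_le one_le_two hp2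
      _ = 4 := by norm_num
  calc |a + b| ^ p ≤ (2 * max |a| |b|) ^ p := rpow_le_rpow (abs_nonneg _) hbase hp0
    _ = 2 ^ p * (max |a| |b|) ^ p := mul_rpow two_pos.le hm
    _ ≤ 4 * (|a| ^ p + |b| ^ p) := by gcongr

lemma abs_rpow_le_one_add_sq {p : ℝ} (hp0 : 0 ≤ p) (hp2 : p ≤ 2) (x : ℝ) :
    |x| ^ p ≤ 1 + x ^ 2 := by
  rcases le_total |x| 1 with h | h
  · linarith [rpow_le_one (abs_nonneg x) h hp0, sq_nonneg x]
  · have := rpow_le_rpow_of_exponent_le h hp2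
    rw [rpow_two, sq_abs] at this
    linarith

lemma wfun_pos (s x : ℝ) : 0 < wfun s x :=
  add_pos_of_pos_of_nonneg one_pos (rpow_nonneg (abs_nonneg x) _)

lemma integrable_inv_wfun {s : ℝ} (hs : s ∈ Set.Ioo (0 : ℝ) 1) :
    Integrable fun y : ℝ => (wfun s y)⁻¹ := by
  have hint : Integrable fun y : ℝ => (1 + ‖y‖) ^ (-(2 - s)) :=
    integrable_one_add_norm (by simp; linarith [hs.2])
  refine (hint.const_mul 4).mono' ?_ (.of_forall fun y => ?_)
  · unfold wfun
    exact (by fun_prop : Measurable fun y : ℝ => (1 + |y| ^ (2 - s))⁻¹).aestronglyMeasurable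
  · have hy : 0 < 1 + |y| := by positivity
    have h := abs_add_rpow_le (p := 2 - s) (by linarith [hs.2]) (by linarith [hs.1]) 1 |y|
    rw [abs_of_pos hy, abs_one, one_rpow, abs_abs] at h
    rw [norm_of_nonneg (inv_nonneg.2 (wfun_pos s y).le), norm_eq_abs, rpow_neg hy.le,
      ← div_eq_mul_inv, inv_le_comm₀ (wfun_pos s y) (by positivity), inv_div,
      div_le_iff₀ four_pos]
    unfold wfun
    linarith

lemma integrable_cauchy_kernel (b : ℝ) : Integrable fun y : ℝ => (1 + (y - b) ^ 2)⁻¹ :=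
  integrable_inv_one_add_sq.comp_sub_right b

lemma wfun_mul_cauchy_kernel_le {s : ℝ} (hs : s ∈ Set.Ioo (0 : ℝ) 1) (b y : ℝ) :
    wfun s b * ((1 + (y - b) ^ 2)⁻¹ * (wfun s y)⁻¹) ≤
      8 * ((1 + (y - b) ^ 2)⁻¹ + (wfun s y)⁻¹) := by
  have hp0 : 0 ≤ 2 - s := by linarith [hs.2]
  have hp2 : 2 - s ≤ 2 := by linarith [hs.1]
  have hk : 0 < 1 + (y - b) ^ 2 := by positivity
  have hw := wfun_pos s y
  have h1 := abs_add_rpow_le hp0 hp2 y (b - y)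
  have h2 := abs_rpow_le_one_add_sq hp0 hp2 (b - y)
  have hb : wfun s b ≤ 8 * (wfun s y + (1 + (y - b) ^ 2)) := by
    rw [add_sub_cancel] at h1
    unfold wfun
    nlinarith [rpow_nonneg (abs_nonneg y) (2 - s), sq_nonneg (y - b)]
  have hsum : (1 + (y - b) ^ 2)⁻¹ + (wfun s y)⁻¹ =
      (wfun s y + (1 + (y - b) ^ 2)) * ((1 + (y - b) ^ 2)⁻¹ * (wfun s y)⁻¹) := by
    field_simp
  rw [hsum, ← mul_assoc 8]
  exact mul_le_mul_of_nonneg_right hb (by positivity)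

lemma integral_kernel_mul_le {s C₀ M b : ℝ} (hs : s ∈ Set.Ioo (0 : ℝ) 1) (hC₀ : 0 < C₀)
    {k u : ℝ → ℝ} (hk0 : ∀ y, 0 ≤ k y) (hk : ∀ y, k y ≤ C₀ / (1 + (y - b) ^ 2))
    (hu : ∀ y, |u y| * wfun s y ≤ M) :
    |∫ y, k y * u y| * wfun s b ≤ 8 * C₀ * (π + ∫ y, (wfun s y)⁻¹) * M := by
  have hw := integrable_inv_wfun hs
  have hc := integrable_cauchy_kernel b
  have hM : 0 ≤ M := (mul_nonneg (abs_nonneg (u 0)) (wfun_pos s 0).le).trans (hu 0)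
  have hle : ∀ y, ‖wfun s b * (k y * u y)‖ ≤
      8 * C₀ * M * ((1 + (y - b) ^ 2)⁻¹ + (wfun s y)⁻¹) := fun y => by
    have huy : |u y| ≤ M * (wfun s y)⁻¹ := by
      rw [← div_eq_mul_inv, le_div_iff₀ (wfun_pos s y)]
      exact hu y
    rw [norm_mul, norm_mul, norm_of_nonneg (wfun_pos s b).le, norm_of_nonneg (hk0 y), norm_eq_abs]
    calc wfun s b * (k y * |u y|)
        ≤ wfun s b * (C₀ / (1 + (y - b) ^ 2) * (M * (wfun s y)⁻¹)) := by
          have := wfun_pos s b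
          gcongr
          exact hk y
      _ = C₀ * M * (wfun s b * ((1 + (y - b) ^ 2)⁻¹ * (wfun s y)⁻¹)) := by ring
      _ ≤ C₀ * M * (8 * ((1 + (y - b) ^ 2)⁻¹ + (wfun s y)⁻¹)) :=
          mul_le_mul_of_nonneg_left (wfun_mul_cauchy_kernel_le hs b y) (by positivity)
      _ = _ := by ring
  have hint : ∫ y, (1 + (y - b) ^ 2)⁻¹ = π := by
    rw [integral_sub_right_eq_self (fun y : ℝ => (1 + y ^ 2)⁻¹) b, integral_univ_inv_one_add_sq]
  calc |∫ y, k y * u y| * wfun s b = ‖∫ y, wfun s b * (k y * u y)‖ := by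
        rw [integral_const_mul, norm_mul, norm_of_nonneg (wfun_pos s b).le, norm_eq_abs, mul_comm]
    _ ≤ ∫ y, 8 * C₀ * M * ((1 + (y - b) ^ 2)⁻¹ + (wfun s y)⁻¹) :=
        norm_integral_le_of_norm_le ((hc.add hw).const_mul _) (.of_forall hle)
    _ = _ := by
        rw [integral_const_mul, integral_add hc hw, hint]
        ring

lemma wfun_div_rpow_le {s t x : ℝ} (hs : s ∈ Set.Ioo (0 : ℝ) 1) (ht : 0 < t) (hx : x ≠ 0)
    (E : ℝ) :
    wfun s x / |x| ^ (2 - s) ≤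
      (1 + 4 * wfun s E / (t ^ 2) ^ (2 - s)) * wfun s (E - t ^ 2 / x) := by
  set p := 2 - s with hp
  set b := E - t ^ 2 / x with hb
  have hxp : 0 < |x| ^ p := rpow_pos_of_pos (abs_pos.2 hx) p
  have htp : 0 < (t ^ 2) ^ p := rpow_pos_of_pos (by positivity) p
  have h1 := abs_add_rpow_le (p := p) (by linarith [hs.2]) (by linarith [hs.1]) E (-b)
  have hEb : E + -b = t ^ 2 / x := by rw [hb]; ring
  rw [hEb, abs_neg, abs_div, abs_of_pos (by positivity : 0 < t ^ 2),
    div_rpow (by positivity) (abs_nonneg x)] at h1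
  have hE := rpow_nonneg (abs_nonneg E) p
  have hbp := rpow_nonneg (abs_nonneg b) p
  have h2 : (|x| ^ p)⁻¹ ≤ 4 * (wfun s E * wfun s b) / (t ^ 2) ^ p := by
    rw [le_div_iff₀ htp, inv_mul_eq_div]
    unfold wfun
    nlinarith
  calc wfun s x / |x| ^ p = 1 + (|x| ^ p)⁻¹ := by
        unfold wfun
        field_simp
        ring
    _ ≤ wfun s b + 4 * (wfun s E * wfun s b) / (t ^ 2) ^ p := by
        refine add_le_add ?_ h2
        unfold wfun
        linarith
    _ = _ := by ring

/-- Let `s ∈ (0,1)`, `t > 0`, `E ∈ ℝ`, `C₀ > 0`, and let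
`q : ℝ → [0,∞)` be measurable with `q(x) ≤ C₀/(1 + (x + E)²)`.  Then there exists
`C = C(s, t, E, C₀) > 0` such that for every measurable `u` with `‖u‖ < ∞`,
`‖Fu‖ ≤ C‖u‖`. -/
theorem stmt7 (s t E C₀ : ℝ) (hs : s ∈ Set.Ioo (0 : ℝ) 1) (ht : 0 < t) (hC₀ : 0 < C₀) :
    ∃ C : ℝ, 0 < C ∧
      ∀ q : ℝ → ℝ, Measurable q → (∀ x, 0 ≤ q x) →
        (∀ x, q x ≤ C₀ / (1 + (x + E) ^ 2)) →
        ∀ u : ℝ → ℝ, Measurable u →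
          BddAbove (Set.range fun x => |u x| * wfun s x) →
          ∀ x : ℝ, |Fop s t q u x| * wfun s x ≤ C * xnorm s u := by
  have hI : 0 ≤ ∫ y, (wfun s y)⁻¹ := integral_nonneg fun y => inv_nonneg.2 (wfun_pos s y).le
  have hE := wfun_pos s E
  set K := 8 * C₀ * (π + ∫ y, (wfun s y)⁻¹) with hK
  set D := 1 + 4 * wfun s E / (t ^ 2) ^ (2 - s) with hD
  have hKpos : 0 < K := by
    have := pi_pos
    positivity
  have hDpos : 0 < D := by positivity
  refine ⟨t ^ (2 - s) * D * K, by positivity, fun q _ hq0 hq u _ hbdd x => ?_⟩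
  have hu : ∀ y, |u y| * wfun s y ≤ xnorm s u := fun y => le_ciSup hbdd y
  have hM : 0 ≤ xnorm s u := (mul_nonneg (abs_nonneg (u 0)) (wfun_pos s 0).le).trans (hu 0)
  rcases eq_or_ne x 0 with rfl | hx
  · simp only [Fop, if_true, abs_zero, zero_mul]
    positivity
  have hker : ∀ y, q (-y - t ^ 2 / x) ≤ C₀ / (1 + (y - (E - t ^ 2 / x)) ^ 2) := fun y => by
    convert hq (-y - t ^ 2 / x) using 3
    ring
  have hint := integral_kernel_mul_le hs hC₀ (fun y => hq0 (-y - t ^ 2 / x)) hker hu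
  have hwx := wfun_div_rpow_le hs ht hx E
  simp only [Fop, if_neg hx]
  set I := ∫ y, q (-y - t ^ 2 / x) * u y
  rw [abs_mul, abs_of_nonneg (by positivity : 0 ≤ t ^ (2 - s) / |x| ^ (2 - s))]
  calc t ^ (2 - s) / |x| ^ (2 - s) * |I| * wfun s x
      = t ^ (2 - s) * |I| * (wfun s x / |x| ^ (2 - s)) := by ring
    _ ≤ t ^ (2 - s) * |I| * (D * wfun s (E - t ^ 2 / x)) := by gcongr
    _ = t ^ (2 - s) * D * (|I| * wfun s (E - t ^ 2 / x)) := by ring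
    _ ≤ t ^ (2 - s) * D * (K * xnorm s u) := by gcongr
    _ = t ^ (2 - s) * D * K * xnorm s u := by ring
end

section
/- Let s ∈ (0,1), t > 0, E ∈ ℝ, and L, C₀, c₀ > 0, and let q be a probability density on ℝ that is Lipschitz with constant L and satisfies c₀/(1 + (x + E)²) ≤ q(x) ≤ C₀/(1 + (x + E)²) for all x ∈ ℝ. Let u : ℝ → [0,∞) be measurable with ‖u‖ < ∞ and ∫_ℝ u(x) dx > 0. Then there exists a constant c > 0 (depending on s, t, E, L, C₀, c₀ and u) such that (F²u)(x) ≥ c/(1 + |x|^{2−s}) for all x ≠ 0. -/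
open MeasureTheory Real

lemma add_rpow_le_two_rpow_mul {a b p : ℝ} (ha : 0 ≤ a) (hb : 0 ≤ b) (hp : 0 ≤ p) :
    (a + b) ^ p ≤ 2 ^ p * (a ^ p + b ^ p) := by
  have key : ∀ m : ℝ, 0 ≤ m → a + b ≤ 2 * m → (a + b) ^ p ≤ 2 ^ p * m ^ p := fun m hm h => by
    rw [← Real.mul_rpow zero_le_two hm]
    exact Real.rpow_le_rpow (by positivity) h hp
  have ha' := Real.rpow_nonneg ha p
  have hb' := Real.rpow_nonneg hb p
  have h2 : (0 : ℝ) ≤ 2 ^ p := by positivity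
  rcases le_total a b with h | h
  · exact (key b hb (by linarith)).trans (by gcongr; linarith)
  · exact (key a ha (by linarith)).trans (by gcongr; linarith)

lemma rpow_abs_le_one_add_sq {p : ℝ} (hp0 : 0 ≤ p) (hp2 : p ≤ 2) (z : ℝ) :
    |z| ^ p ≤ 1 + z ^ 2 := by
  rcases le_total |z| 1 with h | h
  · have := Real.rpow_le_one (abs_nonneg z) h hp0
    nlinarith [sq_nonneg z]
  · have := Real.rpow_le_rpow_of_exponent_le h hp2
    rw [Real.rpow_two, sq_abs] at this
    linarith

lemma one_add_sq_le_mul_shift (z E : ℝ) :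
    1 + z ^ 2 ≤ 2 * (1 + E ^ 2) * (1 + (z + E) ^ 2) := by
  nlinarith [sq_nonneg (z + 2 * E), sq_nonneg (E * (z + E)), sq_nonneg (z + E), sq_nonneg E]

lemma measurable_Fop {s t : ℝ} {q u : ℝ → ℝ} (hq : Measurable q) (hu : Measurable u) :
    Measurable (Fop s t q u) := by
  have h : Measurable fun x : ℝ => ∫ y : ℝ, q (-y - t ^ 2 / x) * u y := by
    have hm : Measurable fun z : ℝ × ℝ => q (-z.2 - t ^ 2 / z.1) * u z.2 := by
      refine (hq.comp ?_).mul (hu.comp measurable_snd)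
      exact measurable_snd.neg.sub (measurable_const.div measurable_fst)
    exact (hm.stronglyMeasurable.integral_prod_right (ν := volume)).measurable
  refine Measurable.ite (measurableSet_singleton 0) measurable_const ?_
  refine Measurable.mul ?_ h
  exact measurable_const.div (measurable_id.abs.pow_const _)

lemma Fop_nonneg {s t : ℝ} {q u : ℝ → ℝ} (ht : 0 < t) (hq : ∀ x, 0 ≤ q x)
    (hu : ∀ x, 0 ≤ u x) (x : ℝ) : 0 ≤ Fop s t q u x := by
  unfold Fop
  split_ifs
  · exact le_rfl
  · have := integral_nonneg (μ := volume) (f := fun y => q (-y - t ^ 2 / x) * u y)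
      fun y => mul_nonneg (hq _) (hu y)
    positivity

lemma integrable_reflect_shift {q : ℝ → ℝ} (hq : Integrable q) (a : ℝ) :
    Integrable fun y => q (-y - a) :=
  (hq.comp_sub_right a).comp_neg

lemma integrable_kernel_mul {q u : ℝ → ℝ} {K : ℝ} (hqm : Measurable q) (hqK : ∀ x, |q x| ≤ K)
    (hu : Integrable u) (a : ℝ) : Integrable fun y => q (-y - a) * u y :=
  hu.bdd_mul (c := K) (hqm.comp (measurable_neg.sub_const a)).aestronglyMeasurable
    (Filter.Eventually.of_forall fun _ => hqK _)

lemma rpow_mul_integral_kernel_le {p K M : ℝ} (hp : 0 ≤ p) {q u : ℝ → ℝ}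
    (hq0 : ∀ x, 0 ≤ q x) (hu0 : ∀ x, 0 ≤ u x) (hqi : Integrable q) (hui : Integrable u)
    (hqK : ∀ z, |z| ^ p * q z ≤ K) (huM : ∀ y, |y| ^ p * u y ≤ M) (a : ℝ)
    (hqu : Integrable fun y => q (-y - a) * u y) :
    |a| ^ p * ∫ y, q (-y - a) * u y ≤ 2 ^ p * (M * (∫ x, q x) + K * ∫ x, u x) := by
  have hshift : ∫ y, q (-y - a) = ∫ x, q x := by
    rw [integral_neg_eq_self (fun y => q (y - a)), integral_sub_right_eq_self]
  have hqs := integrable_reflect_shift hqi a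
  rw [← hshift, ← integral_const_mul, ← integral_const_mul, ← integral_const_mul,
    ← integral_add (hqs.const_mul M) (hui.const_mul K), ← integral_const_mul]
  refine integral_mono (hqu.const_mul _)
    (((hqs.const_mul M).add (hui.const_mul K)).const_mul _) fun y => ?_
  have h1 : |a| ^ p ≤ 2 ^ p * (|y| ^ p + |-y - a| ^ p) := by
    refine le_trans (Real.rpow_le_rpow (abs_nonneg a) ?_ hp)
      (add_rpow_le_two_rpow_mul (abs_nonneg _) (abs_nonneg _) hp)
    have := abs_add_le (-y) (-(-y - a))
    rw [abs_neg, abs_neg] at this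
    simpa using this
  have hq := hq0 (-y - a)
  have hu := hu0 y
  have h2 : (0 : ℝ) ≤ 2 ^ p := by positivity
  calc |a| ^ p * (q (-y - a) * u y)
      ≤ 2 ^ p * (|y| ^ p + |-y - a| ^ p) * (q (-y - a) * u y) := by gcongr
    _ = 2 ^ p * (|y| ^ p * u y * q (-y - a) + |-y - a| ^ p * q (-y - a) * u y) := by ring
    _ ≤ 2 ^ p * (M * q (-y - a) + K * u y) := by
      gcongr
      · exact huM y
      · exact hqK _

lemma exists_Fop_le {s t B : ℝ} (ht : 0 < t) {q u : ℝ → ℝ}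
    (hB : ∀ a : ℝ, |a| ^ (2 - s) * ∫ y, q (-y - a) * u y ≤ B) :
    ∃ b, ∀ x, Fop s t q u x ≤ b := by
  refine ⟨max 0 (B / t ^ (2 - s)), fun x => ?_⟩
  unfold Fop
  split_ifs with hx
  · exact le_max_left _ _
  · refine le_trans ?_ (le_max_right _ _)
    have hx' : 0 < |x| := abs_pos.mpr hx
    have h := hB (t ^ 2 / x)
    rw [abs_div, abs_of_pos (by positivity : 0 < t ^ 2),
      Real.div_rpow (by positivity) hx'.le, pow_two, Real.mul_rpow ht.le ht.le] at h
    rw [le_div_iff₀ (by positivity)]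
    refine le_trans (le_of_eq ?_) h
    rw [pow_two]
    ring

lemma exists_le_Fop {s t E c₀ K : ℝ} (ht : 0 < t) (hc₀ : 0 < c₀) {q u : ℝ → ℝ}
    (hqm : Measurable q) (hqK : ∀ x, |q x| ≤ K) (hlow : ∀ x, c₀ / (1 + (x + E) ^ 2) ≤ q x)
    (hu0 : ∀ x, 0 ≤ u x) (hui : Integrable u) (hint : 0 < ∫ x, u x) :
    ∃ δ : ℝ, 0 < δ ∧ ∀ x : ℝ, 1 ≤ |x| → δ / |x| ^ (2 - s) ≤ Fop s t q u x := by
  set g : ℝ → ℝ := fun y => c₀ / (1 + (|y| + t ^ 2 + |E|) ^ 2)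
  have hgpos : ∀ y, 0 < g y := fun y => by positivity
  have hgle : ∀ y, ‖g y‖ ≤ c₀ := fun y => by
    rw [Real.norm_of_nonneg (hgpos y).le]
    exact div_le_self hc₀.le (by nlinarith [sq_nonneg (|y| + t ^ 2 + |E|)])
  have hgm : Measurable g := by
    fun_prop
  have hgu : Integrable fun y => g y * u y :=
    hui.bdd_mul (c := c₀) hgm.aestronglyMeasurable (Filter.Eventually.of_forall hgle)
  have hpos : 0 < ∫ y, g y * u y := by
    rw [integral_pos_iff_support_of_nonneg (fun y => mul_nonneg (hgpos y).le (hu0 y)) hgu]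
    rw [integral_pos_iff_support_of_nonneg hu0 hui] at hint
    convert hint using 2
    ext y
    simp [(hgpos y).ne']
  refine ⟨t ^ (2 - s) * ∫ y, g y * u y, by positivity, fun x hx => ?_⟩
  have hx0 : x ≠ 0 := by
    rintro rfl
    simp at hx
    linarith
  rw [Fop, if_neg hx0, mul_div_right_comm]
  refine mul_le_mul_of_nonneg_left ?_ (by positivity)
  refine integral_mono hgu (integrable_kernel_mul hqm hqK hui _) fun y => ?_
  refine mul_le_mul_of_nonneg_right (le_trans ?_ (hlow _)) (hu0 y)
  refine div_le_div_of_nonneg_left hc₀.le (by positivity) ?_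
  have habs : |-y - t ^ 2 / x + E| ≤ |y| + t ^ 2 + |E| := by
    have h1 : |t ^ 2 / x| ≤ t ^ 2 := by
      rw [abs_div, abs_of_pos (by positivity : 0 < t ^ 2)]
      exact div_le_self (by positivity) hx
    have h2 := abs_add_le (-y - t ^ 2 / x) E
    have h3 := abs_sub (-y) (t ^ 2 / x)
    rw [abs_neg] at h3
    linarith
  have := pow_le_pow_left₀ (abs_nonneg _) habs 2
  rw [sq_abs] at this
  linarith

/-- A density with a Cauchy lower bound, integrated against a function with `|y|^{-p}` tails,
inherits these tails. -/
lemma le_integral_kernel_of_tail {p m δ : ℝ} (hp : 0 ≤ p) (hδ : 0 ≤ δ)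
    {q v : ℝ → ℝ} (hq0 : ∀ x, 0 ≤ q x) (hv0 : ∀ x, 0 ≤ v x)
    (hqm : ∀ z, |z| ≤ 2 → m ≤ q z) (hv : ∀ y, 1 ≤ |y| → δ / |y| ^ p ≤ v y) (b : ℝ)
    (hqv : Integrable fun y => q (-y - b) * v y) :
    m * (δ / (|b| + 2) ^ p) ≤ ∫ y, q (-y - b) * v y := by
  have key : ∀ l : ℝ, (∀ y ∈ Set.Icc l (l + 1), |-y - b| ≤ 2 ∧ 1 ≤ |y|) →
      m * (δ / (|b| + 2) ^ p) ≤ ∫ y, q (-y - b) * v y := fun l hl => by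
    calc m * (δ / (|b| + 2) ^ p) = ∫ _ in Set.Icc l (l + 1), m * (δ / (|b| + 2) ^ p) := by
          simp
      _ ≤ ∫ y in Set.Icc l (l + 1), q (-y - b) * v y := by
          refine setIntegral_mono_on (integrableOn_const (by simp)) hqv.integrableOn
            measurableSet_Icc fun y hy => ?_
          obtain ⟨h1, h2⟩ := hl y hy
          have hy0 : 0 < |y| := by linarith
          have h3 : |y| ≤ |b| + 2 := by
            have := abs_add_le (-y - b) b
            rw [sub_add_cancel, abs_neg] at this
            linarith
          refine mul_le_mul (hqm _ h1) (le_trans ?_ (hv y h2)) (by positivity) (hq0 _)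
          gcongr
      _ ≤ ∫ y, q (-y - b) * v y :=
          setIntegral_le_integral hqv
            (Filter.Eventually.of_forall fun y => mul_nonneg (hq0 _) (hv0 y))
  rcases le_total b 0 with h | h
  · refine key (-b + 1) fun y hy => ⟨abs_le.mpr ⟨?_, ?_⟩, le_abs.mpr (Or.inl ?_)⟩ <;>
      linarith [hy.1, hy.2]
  · refine key (-b - 2) fun y hy => ⟨abs_le.mpr ⟨?_, ?_⟩, le_abs.mpr (Or.inr ?_)⟩ <;>
      linarith [hy.1, hy.2]

/-- Let `s ∈ (0,1)`, `t > 0`, `E ∈ ℝ`, `L, C₀, c₀ > 0`, and let `q` be a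
probability density, Lipschitz with constant `L`, with
`c₀/(1 + (x + E)²) ≤ q(x) ≤ C₀/(1 + (x + E)²)` for all `x`.  Let `u : ℝ → [0,∞)` be
measurable with `‖u‖ < ∞` and `∫ u > 0`.  Then there exists `c > 0` (depending on all the
data) such that `(F²u)(x) ≥ c/(1 + |x|^{2−s})` for all `x ≠ 0`. -/
theorem stmt10 (s t E L C₀ c₀ : ℝ) (hs : s ∈ Set.Ioo (0 : ℝ) 1) (ht : 0 < t)
    (hL : 0 < L) (hC₀ : 0 < C₀) (hc₀ : 0 < c₀)
    (q : ℝ → ℝ) (hq : IsProbDensity q) (hlip : ∀ x y : ℝ, |q x - q y| ≤ L * |x - y|)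
    (hlow : ∀ x, c₀ / (1 + (x + E) ^ 2) ≤ q x)
    (hupp : ∀ x, q x ≤ C₀ / (1 + (x + E) ^ 2))
    (u : ℝ → ℝ) (hmu : Measurable u) (hu0 : ∀ x, 0 ≤ u x)
    (hbdd : BddAbove (Set.range fun x => |u x| * wfun s x))
    (hint : 0 < ∫ x, u x) :
    ∃ c : ℝ, 0 < c ∧ ∀ x : ℝ, x ≠ 0 →
      c / (1 + |x| ^ (2 - s)) ≤ Fop s t q (Fop s t q u) x := by
  obtain ⟨hqm, hq0, hq1⟩ := hq
  have hqi : Integrable q := by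
    by_contra h
    rw [integral_undef h] at hq1
    exact zero_ne_one hq1
  have hui : Integrable u := by
    by_contra h
    rw [integral_undef h] at hint
    exact lt_irrefl _ hint
  have hp : 0 ≤ 2 - s := by linarith [hs.2]
  have hp2 : 2 - s ≤ 2 := by linarith [hs.1]
  have hqb : ∀ x, |q x| ≤ C₀ := fun x => by
    rw [abs_of_nonneg (hq0 x)]
    exact (hupp x).trans (div_le_self hC₀.le (by nlinarith [sq_nonneg (x + E)]))
  obtain ⟨M, hM⟩ := hbdd
  have huM : ∀ y, |y| ^ (2 - s) * u y ≤ M := fun y => by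
    have h : |u y| * wfun s y ≤ M := hM ⟨y, rfl⟩
    rw [abs_of_nonneg (hu0 y), wfun] at h
    linarith [hu0 y]
  have hqK : ∀ z, |z| ^ (2 - s) * q z ≤ 2 * (1 + E ^ 2) * C₀ := fun z => by
    have h1 := (rpow_abs_le_one_add_sq hp hp2 z).trans (one_add_sq_le_mul_shift z E)
    calc |z| ^ (2 - s) * q z
        ≤ 2 * (1 + E ^ 2) * (1 + (z + E) ^ 2) * (C₀ / (1 + (z + E) ^ 2)) :=
          mul_le_mul h1 (hupp z) (hq0 z) (by positivity)
      _ = 2 * (1 + E ^ 2) * C₀ := by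
          field_simp
  obtain ⟨B, hB⟩ := exists_Fop_le (s := s) ht fun a =>
    rpow_mul_integral_kernel_le hp hq0 hu0 hqi hui hqK huM a
      (integrable_kernel_mul hqm hqb hui a)
  obtain ⟨δ, hδ, hv⟩ := exists_le_Fop (s := s) ht hc₀ hqm hqb hlow hu0 hui hint
  have hv0 := Fop_nonneg (s := s) ht hq0 hu0
  have hvm : Measurable (Fop s t q u) := measurable_Fop hqm hmu
  set v := Fop s t q u
  have hqv : ∀ b, Integrable fun y => q (-y - b) * v y := fun b =>
    (integrable_reflect_shift hqi b).mul_bdd (c := B) hvm.aestronglyMeasurable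
      (Filter.Eventually.of_forall fun y => by
        rw [Real.norm_of_nonneg (hv0 y)]
        exact hB y)
  set m := c₀ / (1 + (2 + |E|) ^ 2)
  have hm : 0 < m := by positivity
  have hqlow : ∀ z, |z| ≤ 2 → m ≤ q z := fun z hz => by
    refine le_trans (div_le_div_of_nonneg_left hc₀.le (by positivity) ?_) (hlow z)
    have h : |z + E| ≤ 2 + |E| := (abs_add_le z E).trans (by linarith)
    have := pow_le_pow_left₀ (abs_nonneg _) h 2
    rw [sq_abs] at this
    linarith
  set D : ℝ := 2 ^ (2 - s) * ((t ^ 2) ^ (2 - s) + 2 ^ (2 - s)) with hD_def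
  have hD : 0 < D := by positivity
  refine ⟨t ^ (2 - s) * (m * δ) / D, by positivity, fun x hx => ?_⟩
  have hx' : 0 < |x| := abs_pos.mpr hx
  have hG := le_integral_kernel_of_tail hp hδ.le hq0 hv0 hqlow hv _ (hqv (t ^ 2 / x))
  have hDx : (t ^ 2 + 2 * |x|) ^ (2 - s) ≤ D * (1 + |x| ^ (2 - s)) := by
    refine (add_rpow_le_two_rpow_mul (by positivity) (by positivity) hp).trans ?_
    rw [Real.mul_rpow zero_le_two hx'.le, hD_def, mul_assoc]
    gcongr
    have h1 : 0 ≤ (t ^ 2) ^ (2 - s) * |x| ^ (2 - s) := by positivity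
    have h2 : (0 : ℝ) ≤ 2 ^ (2 - s) := by positivity
    linarith
  have hprod : (t ^ 2 + 2 * |x|) ^ (2 - s) = |x| ^ (2 - s) * (|t ^ 2 / x| + 2) ^ (2 - s) := by
    rw [← Real.mul_rpow hx'.le (by positivity), abs_div, abs_of_pos (by positivity : 0 < t ^ 2)]
    congr 1
    field_simp
  rw [Fop, if_neg hx]
  calc t ^ (2 - s) * (m * δ) / D / (1 + |x| ^ (2 - s))
      = t ^ (2 - s) * (m * δ) / (D * (1 + |x| ^ (2 - s))) := div_div _ _ _
    _ ≤ t ^ (2 - s) * (m * δ) / (t ^ 2 + 2 * |x|) ^ (2 - s) := by gcongr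
    _ = t ^ (2 - s) / |x| ^ (2 - s) * (m * (δ / (|t ^ 2 / x| + 2) ^ (2 - s))) := by
        rw [hprod]
        field_simp
    _ ≤ t ^ (2 - s) / |x| ^ (2 - s) * ∫ y, q (-y - t ^ 2 / x) * v y := by gcongr
end

section
/- Let s ∈ (0,1), t > 0, E ∈ ℝ, L, C₀ > 0, and let q be a probability density on ℝ that is Lipschitz with constant L and satisfies q(x) ≤ C₀/(1 + (x + E)²) for all x ∈ ℝ. Then the family of functions {x ↦ w(x)·(F²u)(x) : u : ℝ → ℝ measurable with ‖u‖ ≤ 1} is uniformly equicontinuous away from the origin: for every ε > 0 there exists δ > 0 such that for every measurable u with ‖u‖ ≤ 1 and all nonzero x, y ∈ ℝ with |x − y| < δ, |w(x)(F²u)(x) − w(y)(F²u)(y)| ≤ ε. -/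
open MeasureTheory Real

theorem integrable_one_add_abs_rpow_neg {k : ℝ} (hk : 1 < k) :
    Integrable fun x : ℝ => (1 + |x|) ^ (-k) := by
  have h := integrable_one_add_norm (E := ℝ) (μ := volume) (r := k) (by simpa using hk)
  simpa only [Real.norm_eq_abs] using h

theorem one_add_abs_le_mul (y z : ℝ) : 1 + |z| ≤ (1 + |-y - z|) * (1 + |y|) := by
  have h : |z| ≤ |-y - z| + |y| := by
    have := abs_add_le (-y - z) y
    rwa [show -y - z + y = -z by ring, abs_neg] at this
  nlinarith [mul_nonneg (abs_nonneg (-y - z)) (abs_nonneg y)]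

theorem add_rpow_le_four_mul {p a b : ℝ} (hp0 : 0 ≤ p) (hp2 : p ≤ 2) (ha : 0 ≤ a) (hb : 0 ≤ b) :
    (a + b) ^ p ≤ 4 * (a ^ p + b ^ p) := by
  have h2 : (2 : ℝ) ^ p ≤ 4 := by
    calc (2 : ℝ) ^ p ≤ 2 ^ (2 : ℝ) := rpow_le_rpow_of_exponent_le (by norm_num) hp2
      _ = 4 := by norm_num
  have hap : 0 ≤ a ^ p := by positivity
  have hbp : 0 ≤ b ^ p := by positivity
  rcases le_total a b with h | h
  · calc (a + b) ^ p ≤ (2 * b) ^ p := by gcongr; linarith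
      _ = 2 ^ p * b ^ p := mul_rpow (by norm_num) hb
      _ ≤ 4 * b ^ p := by gcongr
      _ ≤ _ := by linarith
  · calc (a + b) ^ p ≤ (2 * a) ^ p := by gcongr; linarith
      _ = 2 ^ p * a ^ p := mul_rpow (by norm_num) ha
      _ ≤ 4 * a ^ p := by gcongr
      _ ≤ _ := by linarith

theorem rpow_sub_rpow_le_mul {p x y : ℝ} (hp : 1 ≤ p) (hy : 0 ≤ y) (hyx : y ≤ x) :
    x ^ p - y ^ p ≤ p * x ^ (p - 1) * (x - y) := by
  rcases hy.trans hyx |>.eq_or_lt with h | hx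
  · obtain rfl : y = x := by linarith
    simp
  · have h := one_add_mul_self_le_rpow_one_add (s := y / x - 1)
      (by linarith [div_nonneg hy hx.le]) hp
    rw [add_sub_cancel, div_rpow hy hx.le, le_div_iff₀ (by positivity)] at h
    have e : x ^ p = x ^ (p - 1) * x := by
      rw [← rpow_add_one hx.ne']; simp
    have e2 : (1 + p * (y / x - 1)) * x ^ p = x ^ p - p * x ^ (p - 1) * (x - y) := by
      rw [e]; field_simp; ring
    linarith

theorem abs_rpow_sub_rpow_le {p x y M : ℝ} (hp : 1 ≤ p) (hx : 0 ≤ x) (hy : 0 ≤ y)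
    (hxM : x ≤ M) (hyM : y ≤ M) :
    |x ^ p - y ^ p| ≤ p * M ^ (p - 1) * |x - y| := by
  wlog h : y ≤ x generalizing x y
  · rw [abs_sub_comm, abs_sub_comm x]
    exact this hy hx hyM hxM (le_of_not_ge h)
  · rw [abs_of_nonneg (sub_nonneg.2 (rpow_le_rpow hy h (by linarith))),
      abs_of_nonneg (sub_nonneg.2 h)]
    refine (rpow_sub_rpow_le_mul hp hy h).trans ?_
    have := sub_nonneg.2 h
    gcongr

/-- The integral `∫ q(-y - z) f(y) dy` in the definition of `Fop`. -/
noncomputable def reflConv (q f : ℝ → ℝ) (z : ℝ) : ℝ := ∫ y : ℝ, q (-y - z) * f y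

theorem integrable_comp_neg_sub {g : ℝ → ℝ} (hg : Integrable g) (z : ℝ) :
    Integrable fun y => g (-y - z) := by
  simpa only [show ∀ y, -z - y = -y - z from fun y => by ring] using hg.comp_sub_left (-z)

theorem integral_comp_neg_sub (g : ℝ → ℝ) (z : ℝ) : ∫ y, g (-y - z) = ∫ y, g y := by
  rw [← integral_sub_left_eq_self g volume (-z)]
  congr 1; ext y; congr 1; ring

theorem abs_integral_le_of_le_add {k D z : ℝ} (hk : 1 < k) {g : ℝ → ℝ}
    (h : ∀ y, |g y| ≤ D * ((1 + |-y - z|) ^ (-k) + (1 + |y|) ^ (-k))) :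
    |∫ y, g y| ≤ 2 * D * ∫ x : ℝ, (1 + |x|) ^ (-k) := by
  have hi := integrable_one_add_abs_rpow_neg hk
  have hj := integrable_comp_neg_sub hi z
  refine (norm_integral_le_of_norm_le (f := g) ((hj.fun_add hi).const_mul D)
    (Filter.Eventually.of_forall h)).trans (le_of_eq ?_)
  rw [integral_const_mul, integral_add hj hi,
    integral_comp_neg_sub (fun x : ℝ => (1 + |x|) ^ (-k)) z]
  ring

section Estimates

variable {p Q U : ℝ} {q f : ℝ → ℝ}

theorem integrable_reflConv (hp : 1 < p) (hqm : Measurable q)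
    (hQ : ∀ x, |q x| ≤ Q * (1 + |x|) ^ (-2 : ℝ)) (hfm : Measurable f)
    (hf : ∀ x, |f x| ≤ U * (1 + |x|) ^ (-p)) (z : ℝ) :
    Integrable fun y => q (-y - z) * f y := by
  have hQ0 : 0 ≤ Q := by simpa using (abs_nonneg _).trans (hQ 0)
  refine ((integrable_one_add_abs_rpow_neg hp).const_mul (Q * U)).mono'
    (by fun_prop) (Filter.Eventually.of_forall fun y => ?_)
  rw [norm_mul, Real.norm_eq_abs, Real.norm_eq_abs]
  have h1 : |q (-y - z)| ≤ Q := (hQ _).trans <| mul_le_of_le_one_right hQ0 <|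
    rpow_le_one_of_one_le_of_nonpos (by linarith [abs_nonneg (-y - z)]) (by norm_num)
  calc _ ≤ Q * (U * (1 + |y|) ^ (-p)) := by gcongr; exact hf y
    _ = _ := by ring

theorem abs_reflConv_mul_le (hp : 1 < p) (hp2 : p ≤ 2)
    (hQ : ∀ x, |q x| ≤ Q * (1 + |x|) ^ (-2 : ℝ))
    (hf : ∀ x, |f x| ≤ U * (1 + |x|) ^ (-p)) (z : ℝ) :
    |reflConv q f z| * (1 + |z|) ^ p ≤ 8 * (Q * U) * ∫ x : ℝ, (1 + |x|) ^ (-p) := by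
  have hQ0 : 0 ≤ Q := by simpa using (abs_nonneg _).trans (hQ 0)
  have hU0 : 0 ≤ U := by simpa using (abs_nonneg _).trans (hf 0)
  rw [← abs_of_nonneg (show 0 ≤ (1 + |z|) ^ p by positivity), ← abs_mul, reflConv,
    ← integral_mul_const]
  refine (abs_integral_le_of_le_add (D := 4 * (Q * U)) (z := z) hp fun y => ?_).trans
    (le_of_eq (by ring))
  rw [abs_mul, abs_mul, abs_of_nonneg (show 0 ≤ (1 + |z|) ^ p by positivity)]
  set a := 1 + |-y - z| with ha
  set b := 1 + |y| with hb
  have ha1 : 1 ≤ a := by linarith [abs_nonneg (-y - z)]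
  have hb1 : 1 ≤ b := by linarith [abs_nonneg y]
  have hc : 1 + |z| ≤ a + b := by
    have := abs_add_le (-y - z) y
    rw [show -y - z + y = -z by ring, abs_neg] at this
    linarith
  have ha0 : 0 < a := by linarith
  have hb0 : 0 < b := by linarith
  calc |q (-y - z)| * |f y| * (1 + |z|) ^ p
      ≤ (Q * a ^ (-2 : ℝ)) * (U * b ^ (-p)) * (4 * (a ^ p + b ^ p)) := by
        gcongr
        · exact hQ _
        · exact hf _
        · exact (rpow_le_rpow (by positivity) hc (by linarith)).trans
            (add_rpow_le_four_mul (by linarith) hp2 ha0.le hb0.le)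
    _ = 4 * (Q * U) * (a ^ (-2 + p) * b ^ (-p) + a ^ (-2 : ℝ) * (b ^ (-p + p))) := by
        rw [rpow_add ha0, rpow_add hb0]; ring
    _ ≤ 4 * (Q * U) * (1 * b ^ (-p) + a ^ (-p) * 1) := by
        gcongr
        · exact rpow_le_one_of_one_le_of_nonpos ha1 (by linarith)
        · simp
    _ = _ := by ring

theorem abs_reflConv_sub_le {L : ℝ} (hp : 1 < p) (hqm : Measurable q)
    (hQ : ∀ x, |q x| ≤ Q * (1 + |x|) ^ (-2 : ℝ))
    (hlip : ∀ x y : ℝ, |q x - q y| ≤ L * |x - y|) (hfm : Measurable f)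
    (hf : ∀ x, |f x| ≤ U * (1 + |x|) ^ (-p)) (z z' : ℝ) :
    |reflConv q f z - reflConv q f z'| ≤ L * U * (∫ x : ℝ, (1 + |x|) ^ (-p)) * |z - z'| := by
  rw [reflConv, reflConv, ← integral_sub (integrable_reflConv hp hqm hQ hfm hf z)
    (integrable_reflConv hp hqm hQ hfm hf z')]
  refine (norm_integral_le_of_norm_le (G := ℝ)
    ((integrable_one_add_abs_rpow_neg hp).const_mul (L * U * |z - z'|))
    (Filter.Eventually.of_forall fun y => ?_)).trans (le_of_eq ?_)
  · rw [← sub_mul, norm_mul, Real.norm_eq_abs, Real.norm_eq_abs]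
    have h := hlip (-y - z) (-y - z')
    rw [show -y - z - (-y - z') = -(z - z') by ring, abs_neg] at h
    calc _ ≤ (L * |z - z'|) * (U * (1 + |y|) ^ (-p)) :=
          mul_le_mul h (hf y) (abs_nonneg _) ((abs_nonneg _).trans h)
      _ = _ := by ring
  · rw [integral_const_mul]; ring

theorem weight_mul_le {r a b : ℝ} (hr2 : r ≤ 2 - p)
    (ha : 1 ≤ a) (hb : 1 ≤ b) :
    a ^ (p - 2) * b ^ (-p) * (a ^ r * b ^ r) ≤ b ^ (-(p - r)) ∧
      a ^ (-1 : ℝ) * b ^ (-1 : ℝ) * (a ^ r * b ^ r) ≤ a ^ (-(p - r)) + b ^ (-(p - r)) := by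
  have ha0 : 0 < a := by linarith
  have hb0 : 0 < b := by linarith
  constructor
  · calc _ = a ^ (p - 2 + r) * b ^ (-p + r) := by rw [rpow_add ha0, rpow_add hb0]; ring
      _ ≤ 1 * b ^ (-p + r) := by
        gcongr
        exact rpow_le_one_of_one_le_of_nonpos ha (by linarith)
      _ = _ := by rw [one_mul]; congr 1; ring
  · have e : ∀ c : ℝ, 1 ≤ c → (c ^ (-1 + r)) ^ 2 ≤ c ^ (-(p - r)) := fun c hc => by
      rw [← rpow_natCast, ← rpow_mul (by linarith)]
      exact rpow_le_rpow_of_exponent_le hc (by push_cast; linarith)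
    calc _ = a ^ (-1 + r) * b ^ (-1 + r) := by rw [rpow_add ha0, rpow_add hb0]; ring
      _ ≤ (a ^ (-1 + r)) ^ 2 + (b ^ (-1 + r)) ^ 2 := by
        nlinarith [sq_nonneg (a ^ (-1 + r) - b ^ (-1 + r)), sq_nonneg (a ^ (-1 + r)),
          sq_nonneg (b ^ (-1 + r))]
      _ ≤ _ := add_le_add (e a ha) (e b hb)

theorem abs_rpow_mul_reflConv_sub_le {V c r : ℝ} (hp2 : p < 2) (hr : 0 ≤ r)
    (hr1 : r < p - 1) (hr2 : r ≤ 2 - p) (hqm : Measurable q) (hqi : Integrable q)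
    (hq1 : ∫ x, q x = 1) (hQ : ∀ x, |q x| ≤ Q * (1 + |x|) ^ (-2 : ℝ)) (hfm : Measurable f)
    (hf : ∀ x, |f x| ≤ U * (1 + |x|) ^ (-p))
    (hfc : ∀ x, |(|x| ^ p * f x - c)| ≤ V * (1 + |x|) ^ (-1 : ℝ)) (z : ℝ) :
    |(|z| ^ p * reflConv q f z - c)| * (1 + |z|) ^ r ≤
      2 * (Q * (16 * U + V)) * ∫ x : ℝ, (1 + |x|) ^ (-(p - r)) := by
  have hQ0 : 0 ≤ Q := by simpa using (abs_nonneg _).trans (hQ 0)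
  have hU0 : 0 ≤ U := by simpa using (abs_nonneg _).trans (hf 0)
  have hV0 : 0 ≤ V := by simpa using (abs_nonneg _).trans (hfc 0)
  have hint : |z| ^ p * reflConv q f z - c
      = ∫ y, (|z| ^ p * (q (-y - z) * f y) - q (-y - z) * c) := by
    rw [integral_sub ((integrable_reflConv (by linarith) hqm hQ hfm hf z).const_mul _)
      ((integrable_comp_neg_sub hqi z).mul_const c), integral_const_mul, integral_mul_const,
      integral_comp_neg_sub q z, hq1, one_mul, reflConv]
  rw [hint, ← abs_of_nonneg (show 0 ≤ (1 + |z|) ^ r by positivity), ← abs_mul,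
    ← integral_mul_const]
  refine abs_integral_le_of_le_add (z := z) (by linarith) fun y => ?_
  rw [abs_mul, abs_of_nonneg (show 0 ≤ (1 + |z|) ^ r by positivity)]
  have hcab := one_add_abs_le_mul y z
  have hyz : |(|z| - |y|)| ≤ |-y - z| := by
    have := abs_abs_sub_abs_le (-z) y
    rwa [abs_neg, show -z - y = -y - z by ring] at this
  have hzle := (abs_le.1 hyz).2
  have hqa := hQ (-y - z)
  have hfb := hf y
  have hfcb := hfc y
  have hya := abs_nonneg y
  have hm := abs_nonneg (-y - z)
  generalize hA : 1 + |-y - z| = a at *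
  generalize hB : 1 + |y| = b at *
  have ha1 : 1 ≤ a := by linarith
  have hb1 : 1 ≤ b := by linarith
  have ha0 : 0 < a := by linarith
  have hb0 : 0 < b := by linarith
  obtain ⟨hw1, hw2⟩ := weight_mul_le hr2 ha1 hb1
  have hpow : |(|z| ^ p - |y| ^ p)| ≤ 8 * a * (a ^ (p - 1) + b ^ (p - 1)) := by
    calc _ ≤ p * (a + b) ^ (p - 1) * |(|z| - |y|)| :=
          abs_rpow_sub_rpow_le (by linarith) (abs_nonneg _) (abs_nonneg _)
            (by linarith) (by linarith)
      _ ≤ 2 * (4 * (a ^ (p - 1) + b ^ (p - 1))) * a := by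
          gcongr
          · exact add_rpow_le_four_mul (by linarith) (by linarith) ha0.le hb0.le
          · linarith
      _ = _ := by ring
  have hmain : |(|z| ^ p * (q (-y - z) * f y) - q (-y - z) * c)| ≤
      Q * (8 * U) * (a ^ (p - 2) * b ^ (-p)) + Q * (8 * U + V) * (a ^ (-1 : ℝ) * b ^ (-1 : ℝ)) := by
    calc _ = |q (-y - z)| * |(|z| ^ p - |y| ^ p) * f y + (|y| ^ p * f y - c)| := by
          rw [← abs_mul]; congr 1; ring
      _ ≤ (Q * a ^ (-2 : ℝ)) * (8 * a * (a ^ (p - 1) + b ^ (p - 1)) * (U * b ^ (-p))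
            + V * b ^ (-1 : ℝ)) := by
          refine mul_le_mul hqa ((abs_add_le _ _).trans (add_le_add ?_ hfcb)) (abs_nonneg _)
            (by positivity)
          rw [abs_mul]
          exact mul_le_mul hpow hfb (abs_nonneg _) (by positivity)
      _ = Q * (8 * U) * (a ^ (p - 2) * b ^ (-p)) + Q * (8 * U) * (a ^ (-1 : ℝ) * b ^ (-1 : ℝ))
            + Q * V * (a ^ (-2 : ℝ) * b ^ (-1 : ℝ)) := by
          have e1 : a ^ (p - 2) = a ^ (-2 : ℝ) * a * a ^ (p - 1) := by
            rw [← rpow_add_one ha0.ne', ← rpow_add ha0]; congr 1; ring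
          have e2 : a ^ (-1 : ℝ) = a ^ (-2 : ℝ) * a := by
            rw [← rpow_add_one ha0.ne']; congr 1; ring
          have e3 : b ^ (-1 : ℝ) = b ^ (p - 1) * b ^ (-p) := by
            rw [← rpow_add hb0]; congr 1; ring
          rw [e1, e2, e3]; ring
      _ ≤ Q * (8 * U) * (a ^ (p - 2) * b ^ (-p)) + Q * (8 * U) * (a ^ (-1 : ℝ) * b ^ (-1 : ℝ))
            + Q * V * (a ^ (-1 : ℝ) * b ^ (-1 : ℝ)) := by
          gcongr
          · norm_num
      _ = _ := by ring
  have hcr : (1 + |z|) ^ r ≤ a ^ r * b ^ r := by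
    rw [← mul_rpow ha0.le hb0.le]
    exact rpow_le_rpow (by positivity) hcab hr
  calc _ ≤ (Q * (8 * U) * (a ^ (p - 2) * b ^ (-p))
          + Q * (8 * U + V) * (a ^ (-1 : ℝ) * b ^ (-1 : ℝ))) * (a ^ r * b ^ r) := by gcongr
    _ = Q * (8 * U) * (a ^ (p - 2) * b ^ (-p) * (a ^ r * b ^ r))
          + Q * (8 * U + V) * (a ^ (-1 : ℝ) * b ^ (-1 : ℝ) * (a ^ r * b ^ r)) := by ring
    _ ≤ Q * (8 * U) * (a ^ (-(p - r)) + b ^ (-(p - r)))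
          + Q * (8 * U + V) * (a ^ (-(p - r)) + b ^ (-(p - r))) := by
        gcongr
        exact hw1.trans (le_add_of_nonneg_left (by positivity))
    _ = _ := by ring

end Estimates

theorem exists_forall_abs_comp_div_sub_le {T M r ε : ℝ} (hT : 0 < T) (hr : 0 < r)
    (N : ℝ → ℝ) (hε : 0 < ε) :
    ∃ δ : ℝ, 0 < δ ∧ ∀ (h : ℝ → ℝ) (c : ℝ), (∀ z, |h z - c| ≤ M * (1 + |z|) ^ (-r)) →
      (∀ R z z', |z| ≤ R → |z'| ≤ R → |h z - h z'| ≤ N R * |z - z'|) →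
      ∀ x y : ℝ, x ≠ 0 → y ≠ 0 → |x - y| < δ → |h (T / x) - h (T / y)| ≤ ε := by
  have hlim : Filter.Tendsto (fun w : ℝ => M * (1 + w) ^ (-r)) Filter.atTop (nhds 0) := by
    simpa using ((tendsto_rpow_neg_atTop hr).comp
      (Filter.tendsto_atTop_add_const_left _ (1 : ℝ) Filter.tendsto_id)).const_mul M
  obtain ⟨R, hR⟩ := Filter.eventually_atTop.1
    ((hlim.eventually_le_const (half_pos hε)).and (Filter.eventually_gt_atTop 0))
  have hR0 : 0 < R := (hR R le_rfl).2
  set η := T / R / 2 with hη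
  have hη0 : 0 < η := by positivity
  set B := |N (T / η)| * (T / η ^ 2) with hB
  have hB0 : 0 ≤ B := by positivity
  refine ⟨min η (ε / (B + 1)), by positivity, fun h c hc hN x y hx hy hxy => ?_⟩
  have hxy1 := hxy.trans_le (min_le_left _ _)
  have hxy2 := hxy.trans_le (min_le_right _ _)
  have hx0 := abs_pos.2 hx
  have hy0 := abs_pos.2 hy
  have hnear : ∀ x : ℝ, x ≠ 0 → |x| ≤ 2 * η → |h (T / x) - c| ≤ ε / 2 := fun x hx hxη => by
    refine (hc _).trans (hR _ ?_).1
    have : |x| ≤ T / R := by linarith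
    rw [abs_div, abs_of_pos hT, le_div_iff₀ (abs_pos.2 hx)]
    rw [le_div_iff₀ hR0] at this
    linarith
  have hd := abs_sub_abs_le_abs_sub x y
  have hd' := abs_sub_abs_le_abs_sub y x
  rw [abs_sub_comm] at hd'
  by_cases hsmall : |x| < η ∨ |y| < η
  · have h1 := hnear x hx (by rcases hsmall with h | h <;> linarith)
    have h2 := hnear y hy (by rcases hsmall with h | h <;> linarith)
    rw [abs_sub_comm] at h2
    linarith [abs_sub_le (h (T / x)) c (h (T / y))]
  · push Not at hsmall
    obtain ⟨hxη, hyη⟩ := hsmall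
    have hle : ∀ x : ℝ, η ≤ |x| → |T / x| ≤ T / η := fun x hx => by
      rw [abs_div, abs_of_pos hT]; gcongr
    calc _ ≤ N (T / η) * |T / x - T / y| := hN _ _ _ (hle x hxη) (hle y hyη)
      _ ≤ |N (T / η)| * (T / η ^ 2 * |x - y|) := by
          gcongr
          · exact le_abs_self _
          · rw [show T / x - T / y = T / (x * y) * (y - x) by field_simp, abs_mul, abs_div,
              abs_of_pos hT, abs_mul, abs_sub_comm y, sq]
            gcongr
      _ = B * |x - y| := by rw [hB]; ring
      _ ≤ (B + 1) * (ε / (B + 1)) := by gcongr; linarith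
      _ = ε := by field_simp

section Weighted

variable {p r A K K' Λ c : ℝ} {g : ℝ → ℝ}

theorem abs_weighted_sub_le (hA : 0 < A) (hrp : r ≤ p)
    (hg : ∀ z, |g z| * (1 + |z|) ^ p ≤ K)
    (hgc : ∀ z, |(|z| ^ p * g z - c)| * (1 + |z|) ^ r ≤ K') (z : ℝ) :
    |A * g z + A⁻¹ * (|z| ^ p * g z) - A⁻¹ * c| ≤ (A * K + A⁻¹ * K') * (1 + |z|) ^ (-r) := by
  have h1 : 1 ≤ 1 + |z| := by linarith [abs_nonneg z]
  rw [rpow_neg (by positivity), ← div_eq_mul_inv, le_div_iff₀ (by positivity)]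
  have h2 : |g z| * (1 + |z|) ^ r ≤ K := le_trans (by gcongr) (hg z)
  calc _ ≤ (A * |g z| + A⁻¹ * |(|z| ^ p * g z - c)|) * (1 + |z|) ^ r := by
        gcongr
        rw [add_sub_assoc, ← mul_sub]
        refine (abs_add_le _ _).trans (le_of_eq ?_)
        rw [abs_mul, abs_mul, abs_of_pos hA, abs_of_pos (inv_pos.2 hA)]
    _ = A * (|g z| * (1 + |z|) ^ r) + A⁻¹ * (|(|z| ^ p * g z - c)| * (1 + |z|) ^ r) := by ring
    _ ≤ _ := by gcongr; exact hgc z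

theorem abs_weighted_sub_weighted_le (hA : 0 < A) (hp : 1 ≤ p)
    (hg : ∀ z, |g z| * (1 + |z|) ^ p ≤ K) (hlip : ∀ z z', |g z - g z'| ≤ Λ * |z - z'|)
    (R z z' : ℝ) (hz : |z| ≤ R) (hz' : |z'| ≤ R) :
    |(A * g z + A⁻¹ * (|z| ^ p * g z)) - (A * g z' + A⁻¹ * (|z'| ^ p * g z'))| ≤
      (A * Λ + A⁻¹ * (R ^ p * Λ + p * R ^ (p - 1) * K)) * |z - z'| := by
  have hR : 0 ≤ R := (abs_nonneg z).trans hz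
  have hK : |g z'| ≤ K := le_trans (le_mul_of_one_le_right (abs_nonneg _)
    (one_le_rpow (by linarith [abs_nonneg z']) (by linarith))) (hg z')
  have hpow : |(|z| ^ p - |z'| ^ p)| ≤ p * R ^ (p - 1) * |z - z'| :=
    (abs_rpow_sub_rpow_le hp (abs_nonneg z) (abs_nonneg z') hz hz').trans
      (by refine mul_le_mul_of_nonneg_left (abs_abs_sub_abs_le z z') (by positivity))
  calc _ = |A * (g z - g z') + A⁻¹ * (|z| ^ p * (g z - g z') + (|z| ^ p - |z'| ^ p) * g z')| := by
        congr 1; ring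
    _ ≤ A * |g z - g z'| + A⁻¹ * (|z| ^ p * |g z - g z'| + |(|z| ^ p - |z'| ^ p)| * |g z'|) := by
        refine (abs_add_le _ _).trans ?_
        rw [abs_mul, abs_mul, abs_of_pos hA, abs_of_pos (inv_pos.2 hA)]
        gcongr
        refine (abs_add_le _ _).trans (le_of_eq ?_)
        rw [abs_mul, abs_mul, abs_of_nonneg (show 0 ≤ |z| ^ p by positivity)]
    _ ≤ A * (Λ * |z - z'|) + A⁻¹ * (R ^ p * (Λ * |z - z'|)
          + p * R ^ (p - 1) * |z - z'| * K) := by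
        gcongr <;> exact hlip z z'
    _ = _ := by ring

end Weighted

theorem Fop_eq {s : ℝ} (hs : s < 2) (t : ℝ) (q u : ℝ → ℝ) (x : ℝ) :
    Fop s t q u x = t ^ (2 - s) / |x| ^ (2 - s) * reflConv q u (t ^ 2 / x) := by
  unfold Fop reflConv
  split_ifs with h
  · rw [h, abs_zero, zero_rpow (by linarith), div_zero, zero_mul]
  · rfl

theorem abs_sq_div_rpow {t : ℝ} (ht : 0 < t) (p x : ℝ) :
    |t ^ 2 / x| ^ p = t ^ p * t ^ p / |x| ^ p := by
  rw [abs_div, abs_of_pos (by positivity : 0 < t ^ 2), div_rpow (by positivity) (abs_nonneg x), sq,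
    mul_rpow ht.le ht.le]

theorem wfun_mul_Fop_eq {s t : ℝ} (hs : s < 2) (ht : 0 < t) (q v : ℝ → ℝ) {x : ℝ} (hx : x ≠ 0) :
    wfun s x * Fop s t q v x = t ^ (2 - s) * reflConv q v (t ^ 2 / x)
      + (t ^ (2 - s))⁻¹ * (|t ^ 2 / x| ^ (2 - s) * reflConv q v (t ^ 2 / x)) := by
  have h1 : 0 < |x| ^ (2 - s) := rpow_pos_of_pos (abs_pos.2 hx) _
  have h2 : 0 < t ^ (2 - s) := rpow_pos_of_pos ht _
  rw [Fop_eq hs, wfun, abs_sq_div_rpow ht]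
  field_simp
  ring

section Fop

variable {s t K Λ : ℝ} {q u : ℝ → ℝ}

theorem abs_Fop_le (hs0 : 0 ≤ s) (hs : s < 2) (ht : 0 < t)
    (hK : ∀ z, |reflConv q u z| * (1 + |z|) ^ (2 - s) ≤ K) (x : ℝ) :
    |Fop s t q u x| ≤
      4 * ((t ^ (2 - s))⁻¹ * K + t ^ (2 - s) * K) * (1 + |x|) ^ (-(2 - s)) := by
  have hA : 0 < t ^ (2 - s) := rpow_pos_of_pos ht _
  have hK0 : 0 ≤ K := le_trans (by positivity) (hK 0)
  rw [rpow_neg (by positivity), ← div_eq_mul_inv, le_div_iff₀ (by positivity)]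
  rcases eq_or_ne x 0 with rfl | hx
  · rw [Fop, if_pos rfl, abs_zero, zero_mul]; positivity
  have hX : 0 < |x| ^ (2 - s) := rpow_pos_of_pos (abs_pos.2 hx) _
  have h1 : |Fop s t q u x| ≤ (t ^ (2 - s))⁻¹ * K := by
    have h : |reflConv q u (t ^ 2 / x)| * |t ^ 2 / x| ^ (2 - s) ≤ K :=
      le_trans (by gcongr; linarith) (hK (t ^ 2 / x))
    rw [abs_sq_div_rpow ht] at h
    rw [Fop_eq hs, abs_mul, abs_of_pos (by positivity)]
    calc _ = (t ^ (2 - s))⁻¹ * (|reflConv q u (t ^ 2 / x)| *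
          (t ^ (2 - s) * t ^ (2 - s) / |x| ^ (2 - s))) := by field_simp
      _ ≤ _ := by gcongr
  have h2 : |Fop s t q u x| * |x| ^ (2 - s) ≤ t ^ (2 - s) * K := by
    have h : |reflConv q u (t ^ 2 / x)| ≤ K := le_trans (le_mul_of_one_le_right (abs_nonneg _)
      (one_le_rpow (by linarith [abs_nonneg (t ^ 2 / x)]) (by linarith))) (hK (t ^ 2 / x))
    rw [Fop_eq hs, abs_mul, abs_of_pos (by positivity)]
    calc _ = t ^ (2 - s) * |reflConv q u (t ^ 2 / x)| := by field_simp
      _ ≤ _ := by gcongr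
  calc _ ≤ |Fop s t q u x| * (4 * (1 ^ (2 - s) + |x| ^ (2 - s))) := by
        gcongr
        exact add_rpow_le_four_mul (by linarith) (by linarith) zero_le_one (abs_nonneg x)
    _ = 4 * (|Fop s t q u x| + |Fop s t q u x| * |x| ^ (2 - s)) := by rw [one_rpow]; ring
    _ ≤ _ := by gcongr

theorem abs_rpow_mul_Fop_sub_le (hs : s < 2) (ht : 0 < t)
    (hK : ∀ z, |reflConv q u z| ≤ K)
    (hlip : ∀ z z', |reflConv q u z - reflConv q u z'| ≤ Λ * |z - z'|) (x : ℝ) :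
    |(|x| ^ (2 - s) * Fop s t q u x - t ^ (2 - s) * reflConv q u 0)| ≤
      t ^ (2 - s) * (2 * (Λ * t ^ 2) + 4 * K) * (1 + |x|) ^ (-1 : ℝ) := by
  have hA : 0 < t ^ (2 - s) := rpow_pos_of_pos ht _
  have hK0 : 0 ≤ K := le_trans (by positivity) (hK 0)
  have hΛ : 0 ≤ Λ := by simpa using (abs_nonneg _).trans (hlip 1 0)
  rw [rpow_neg_one, ← div_eq_mul_inv, le_div_iff₀ (by positivity)]
  rcases eq_or_ne x 0 with rfl | hx
  · rw [Fop, if_pos rfl, mul_zero, zero_sub, abs_neg, abs_mul, abs_of_pos hA, abs_zero, add_zero,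
      mul_one]
    gcongr
    have : 0 ≤ 2 * (Λ * t ^ 2) := by positivity
    linarith [hK 0]
  have hX : 0 < |x| ^ (2 - s) := rpow_pos_of_pos (abs_pos.2 hx) _
  have e : |x| ^ (2 - s) * Fop s t q u x - t ^ (2 - s) * reflConv q u 0
      = t ^ (2 - s) * (reflConv q u (t ^ 2 / x) - reflConv q u 0) := by
    rw [Fop_eq hs]; field_simp
  rw [e, abs_mul, abs_of_pos hA, mul_assoc]
  gcongr
  have h1 : |reflConv q u (t ^ 2 / x) - reflConv q u 0| ≤ 2 * K := by
    linarith [abs_sub (reflConv q u (t ^ 2 / x)) (reflConv q u 0), hK 0, hK (t ^ 2 / x)]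
  have h2 : |reflConv q u (t ^ 2 / x) - reflConv q u 0| * |x| ≤ Λ * t ^ 2 := by
    have h := hlip (t ^ 2 / x) 0
    have hx0 := abs_pos.2 hx
    rwa [sub_zero, abs_div, abs_of_pos (by positivity : 0 < t ^ 2), ← mul_div_assoc,
      le_div_iff₀ hx0] at h
  have : 0 ≤ Λ * t ^ 2 := by positivity
  linarith

theorem measurable_Fop_s11 (hs : s < 2) (t : ℝ)
    (hlip : ∀ z z', |reflConv q u z - reflConv q u z'| ≤ Λ * |z - z'|) :
    Measurable (Fop s t q u) := by
  have hc : Continuous (reflConv q u) :=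
    (LipschitzWith.of_dist_le' (K := Λ) fun z z' => by
      simpa only [Real.dist_eq] using hlip z z').continuous
  rw [show Fop s t q u = _ from funext (Fop_eq hs t q u)]
  have := hc.measurable
  fun_prop

end Fop

theorem one_add_sq_inv_le (E x : ℝ) :
    (1 + (x + E) ^ 2)⁻¹ ≤ 2 * (1 + |E|) ^ 2 * (1 + |x|) ^ (-2 : ℝ) := by
  rw [rpow_neg (by positivity), ← div_eq_mul_inv, inv_le_comm₀ (by positivity) (by positivity),
    inv_div, div_le_iff₀ (by positivity)]
  have h : 1 + |x| ≤ (1 + |E|) * (1 + |x + E|) := by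
    have h2 := one_add_abs_le_mul (-E) (-x)
    rw [abs_neg, abs_neg, show - -E - -x = x + E by ring] at h2
    linarith
  have h3 : (1 + |x|) ^ (2 : ℝ) ≤ ((1 + |E|) * (1 + |x + E|)) ^ 2 := by
    rw [rpow_two]; gcongr
  have h4 : (1 + |x + E|) ^ 2 ≤ 2 * (1 + (x + E) ^ 2) := by
    rw [← sq_abs (x + E)]; nlinarith [sq_nonneg (1 - |x + E|)]
  calc _ ≤ _ := h3
    _ = (1 + |E|) ^ 2 * (1 + |x + E|) ^ 2 := by ring
    _ ≤ (1 + |E|) ^ 2 * (2 * (1 + (x + E) ^ 2)) := by gcongr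
    _ = _ := by ring

theorem abs_le_of_abs_mul_wfun_le {s : ℝ} (hs0 : 0 ≤ s) (hs : s ≤ 2) {u : ℝ → ℝ}
    (hu : ∀ x, |u x| * wfun s x ≤ 1) (x : ℝ) : |u x| ≤ 4 * (1 + |x|) ^ (-(2 - s)) := by
  rw [rpow_neg (by positivity), ← div_eq_mul_inv, le_div_iff₀ (by positivity)]
  calc _ ≤ |u x| * (4 * (1 ^ (2 - s) + |x| ^ (2 - s))) := by
        gcongr
        exact add_rpow_le_four_mul (by linarith) (by linarith) zero_le_one (abs_nonneg x)
    _ = 4 * (|u x| * wfun s x) := by rw [one_rpow, wfun]; ring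
    _ ≤ 4 := by linarith [hu x]

/-- Let `s ∈ (0,1)`, `t > 0`, `E ∈ ℝ`, `L, C₀ > 0`, and let `q` be a
probability density, Lipschitz with constant `L`, with `q(x) ≤ C₀/(1 + (x + E)²)`.  Then
the family `{x ↦ w(x)·(F²u)(x) : ‖u‖ ≤ 1}` is uniformly equicontinuous away from the
origin: for every `ε > 0` there is `δ > 0` such that for every measurable `u` with
`‖u‖ ≤ 1` and nonzero `x, y` with `|x − y| < δ`,
`|w(x)(F²u)(x) − w(y)(F²u)(y)| ≤ ε`. -/
theorem stmt11 (s t E L C₀ : ℝ) (hs : s ∈ Set.Ioo (0 : ℝ) 1) (ht : 0 < t)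
    (hL : 0 < L) (hC₀ : 0 < C₀)
    (q : ℝ → ℝ) (hq : IsProbDensity q) (hlip : ∀ x y : ℝ, |q x - q y| ≤ L * |x - y|)
    (hupp : ∀ x, q x ≤ C₀ / (1 + (x + E) ^ 2)) :
    ∀ ε : ℝ, 0 < ε → ∃ δ : ℝ, 0 < δ ∧
      ∀ u : ℝ → ℝ, Measurable u → (∀ x, |u x| * wfun s x ≤ 1) →
        ∀ x y : ℝ, x ≠ 0 → y ≠ 0 → |x - y| < δ →
          |wfun s x * Fop s t q (Fop s t q u) x - wfun s y * Fop s t q (Fop s t q u) y|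
            ≤ ε := by
  obtain ⟨hs0, hs1⟩ := hs
  have hs2 : s < 2 := by linarith
  obtain ⟨hqm, hq0, hq1⟩ := hq
  have hqi : Integrable q := by
    by_contra h
    rw [integral_undef h] at hq1
    exact zero_ne_one hq1
  obtain ⟨Q, hQ⟩ : ∃ Q, ∀ x, |q x| ≤ Q * (1 + |x|) ^ (-2 : ℝ) :=
    ⟨C₀ * (2 * (1 + |E|) ^ 2), fun x => by
      rw [abs_of_nonneg (hq0 x), mul_assoc]
      exact (hupp x).trans (mul_le_mul_of_nonneg_left (one_add_sq_inv_le E x) hC₀.le)⟩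
  obtain ⟨r, hr0, hr1, hr2⟩ : ∃ r, 0 < r ∧ r < (2 - s) - 1 ∧ r ≤ 2 - (2 - s) :=
    ⟨min s ((1 - s) / 2), by rw [lt_min_iff]; constructor <;> linarith,
      (min_le_right _ _).trans_lt (by linarith), (min_le_left _ _).trans (by linarith)⟩
  have hA : 0 < t ^ (2 - s) := rpow_pos_of_pos ht _
  have hp : 1 < 2 - s := by linarith
  intro ε hε
  set J := ∫ x : ℝ, (1 + |x|) ^ (-(2 - s)) with hJ
  set K := 8 * (Q * 4) * J with hK
  set U := 4 * ((t ^ (2 - s))⁻¹ * K + t ^ (2 - s) * K) with hU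
  set V := t ^ (2 - s) * (2 * (L * 4 * J * t ^ 2) + 4 * K) with hV
  set K₁ := 8 * (Q * U) * J with hK₁
  set K₂ := 2 * (Q * (16 * U + V)) * ∫ x : ℝ, (1 + |x|) ^ (-((2 - s) - r)) with hK₂
  obtain ⟨δ, hδ, hequi⟩ := exists_forall_abs_comp_div_sub_le (T := t ^ 2)
    (M := t ^ (2 - s) * K₁ + (t ^ (2 - s))⁻¹ * K₂) (by positivity) hr0
    (fun R => t ^ (2 - s) * (L * U * J) + (t ^ (2 - s))⁻¹ *
      (R ^ (2 - s) * (L * U * J) + (2 - s) * R ^ (2 - s - 1) * K₁)) hε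
  refine ⟨δ, hδ, fun u hum hu x y hx hy hxy => ?_⟩
  have huU := abs_le_of_abs_mul_wfun_le hs0.le hs2.le hu
  have huK := abs_reflConv_mul_le hp (by linarith) hQ huU
  have huK' : ∀ z, |reflConv q u z| ≤ K := fun z => le_trans
    (le_mul_of_one_le_right (abs_nonneg _)
      (one_le_rpow (by linarith [abs_nonneg z]) (by linarith))) (huK z)
  have hulip := abs_reflConv_sub_le hp hqm hQ hlip hum huU
  have hvm : Measurable (Fop s t q u) := measurable_Fop_s11 hs2 t hulip
  have hvU := abs_Fop_le hs0.le hs2 ht huK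
  have hvc := abs_rpow_mul_Fop_sub_le hs2 ht huK' hulip
  have hvK := abs_reflConv_mul_le hp (by linarith) hQ hvU
  have hvlip := abs_reflConv_sub_le hp hqm hQ hlip hvm hvU
  have hvlim := abs_rpow_mul_reflConv_sub_le (by linarith) hr0.le hr1 hr2 hqm hqi hq1 hQ hvm hvU hvc
  rw [wfun_mul_Fop_eq hs2 ht _ _ hx, wfun_mul_Fop_eq hs2 ht _ _ hy]
  exact hequi (fun z => t ^ (2 - s) * reflConv q (Fop s t q u) z
      + (t ^ (2 - s))⁻¹ * (|z| ^ (2 - s) * reflConv q (Fop s t q u) z)) _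
    (abs_weighted_sub_le hA (by linarith) hvK hvlim)
    (abs_weighted_sub_weighted_le hA hp.le hvK hvlip) x y hx hy hxy
end
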